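/- Corollary of the main theorem for the composite constraint: let (D_+, D_-) be a labeled database, σ_+, σ_- nonnegative integers, θ ≥ 0 a real, P a pattern and a a literal not occurring in P with Sup_-(P) = Sup_-(P + a). Then for every pattern Z with P + a ⊆ Z, Z is not a minimal pattern of the composite constraint CP[σ_+, σ_-] ∩ GR[θ], i.e. Z ∉ MIN(CP[σ_+, σ_-] ∩ GR[θ]). -/

import Mathlib

/-- A generalized itemset (pattern) over an item alphabet `I`:
a set of positive literals and a set of negated items. -/
structure Pattern (I : Type*) where
  pos : Finset I
  neg : Finset I

variable {I : Type*} [Fintype I] [DecidableEq I]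

/-- `X` occurs in tuple `t` (`X ⊑ t`): every item of `X.pos` is in `t`
and no item of `X.neg` is in `t`. -/
def occursIn (X : Pattern I) (t : Finset I) : Prop :=
  (∀ x ∈ X.pos, x ∈ t) ∧ (∀ x ∈ X.neg, x ∉ t)

instance (X : Pattern I) (t : Finset I) : Decidable (occursIn X t) :=
  inferInstanceAs (Decidable (_ ∧ _))

/-- Occurrence list `Occ_D(X) = {t ∈ D : X ⊑ t}`. -/
def Occ (D : Finset (Finset I)) (X : Pattern I) : Finset (Finset I) :=
  D.filter (fun t => occursIn X t)

/-- Support `Sup_D(X) = |Occ_D(X)|`. -/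
def supp (D : Finset (Finset I)) (X : Pattern I) : ℕ := (Occ D X).card

/-- A literal: an item (`inl`) or a negated item (`inr`). -/
abbrev Lit (I : Type*) := I ⊕ I

/-- `P + a`: add literal `a` to pattern `P`. -/
def addLit (P : Pattern I) (a : Lit I) : Pattern I :=
  match a with
  | .inl x => ⟨insert x P.pos, P.neg⟩
  | .inr x => ⟨P.pos, insert x P.neg⟩

/-- `Z \ {a}`: remove literal `a` from pattern `Z`. -/
def removeLit (P : Pattern I) (a : Lit I) : Pattern I :=
  match a with
  | .inl x => ⟨P.pos.erase x, P.neg⟩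
  | .inr x => ⟨P.pos, P.neg.erase x⟩

/-- Literal `a` occurs in pattern `P`. -/
def litMem (a : Lit I) (P : Pattern I) : Prop :=
  match a with
  | .inl x => x ∈ P.pos
  | .inr x => x ∈ P.neg

/-- Pattern inclusion: componentwise inclusion of positive and negated parts. -/
def subPat (P Q : Pattern I) : Prop := P.pos ⊆ Q.pos ∧ P.neg ⊆ Q.neg

/-- Pattern union: componentwise union. -/
def unionPat (P Q : Pattern I) : Pattern I := ⟨P.pos ∪ Q.pos, P.neg ∪ Q.neg⟩

/-- `MIN ℂ`: patterns in `ℂ` with no proper subset in `ℂ`. -/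
def MinC (C : Set (Pattern I)) : Set (Pattern I) :=
  {X ∈ C | ∀ Y : Pattern I, subPat Y X → Y ≠ X → Y ∉ C}

/-- Condition C1'. -/
def CondC1' (Dm : Finset (Finset I)) (C : Set (Pattern I)) : Prop :=
  ∀ (P : Pattern I) (a : Lit I),
    supp Dm P = supp Dm (addLit P a) → addLit P a ∈ C → P ∈ C

/-- Condition C2'. -/
def CondC2' (Dp Dm : Finset (Finset I)) (C : Set (Pattern I)) : Prop :=
  ∀ P Q : Pattern I, Occ Dp P = Occ Dp Q → Occ Dm P = Occ Dm Q → (P ∈ C ↔ Q ∈ C)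

/-- Contrast constraint `CP[σ₊, σ₋]`. -/
def CPset (Dp Dm : Finset (Finset I)) (σp σm : ℕ) : Set (Pattern I) :=
  {X | σp ≤ supp Dp X ∧ supp Dm X ≤ σm}

/-- Growth-rate constraint `GR[θ]` (division-free form). -/
def GRset (Dp Dm : Finset (Finset I)) (θ : ℝ) : Set (Pattern I) :=
  {X | θ * (supp Dm X : ℝ) ≤ (supp Dp X : ℝ)}

theorem occursIn_addLit_iff (P : Pattern I) (a : Lit I) (t : Finset I) :
    occursIn (addLit P a) t ↔ occursIn (addLit ⟨∅, ∅⟩ a) t ∧ occursIn P t := by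
  cases a <;> simp [occursIn, addLit] <;> tauto

theorem occursIn_of_subPat {P Q : Pattern I} (hPQ : subPat P Q) {t : Finset I}
    (hQ : occursIn Q t) : occursIn P t :=
  ⟨fun x hx => hQ.1 x (hPQ.1 hx), fun x hx => hQ.2 x (hPQ.2 hx)⟩

theorem Occ_subset_of_subPat (D : Finset (Finset I)) {P Q : Pattern I} (hPQ : subPat P Q) :
    Occ D Q ⊆ Occ D P :=
  Finset.monotone_filter_right D fun _ _ => occursIn_of_subPat hPQ

theorem subPat_addLit (P : Pattern I) (a : Lit I) : subPat P (addLit P a) := by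
  cases a <;> simp [subPat, addLit]

theorem litMem_of_subPat_addLit {P Z : Pattern I} {a : Lit I} (hZ : subPat (addLit P a) Z) :
    litMem a Z := by
  cases a
  · exact hZ.1 (Finset.mem_insert_self _ _)
  · exact hZ.2 (Finset.mem_insert_self _ _)

theorem subPat_removeLit (Z : Pattern I) (a : Lit I) : subPat (removeLit Z a) Z := by
  cases a <;> simp [subPat, removeLit, Finset.erase_subset]

theorem not_litMem_removeLit (Z : Pattern I) (a : Lit I) : ¬ litMem a (removeLit Z a) := by
  cases a <;> simp [litMem, removeLit]

theorem addLit_removeLit {Z : Pattern I} {a : Lit I} (ha : litMem a Z) :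
    addLit (removeLit Z a) a = Z := by
  cases a <;> simp_all [addLit, removeLit, litMem, Finset.insert_erase]

theorem subPat_removeLit_of_subPat_addLit {P Z : Pattern I} {a : Lit I} (ha : ¬ litMem a P)
    (hZ : subPat (addLit P a) Z) : subPat P (removeLit Z a) := by
  cases a
  · exact ⟨Finset.subset_erase.2 ⟨(Finset.subset_insert _ _).trans hZ.1, ha⟩, hZ.2⟩
  · exact ⟨hZ.1, Finset.subset_erase.2 ⟨(Finset.subset_insert _ _).trans hZ.2, ha⟩⟩

/-- If adding `a` to `P` does not change the support, then neither does removing `a` from a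
pattern that contains `P + a`. -/
theorem Occ_removeLit_eq {D : Finset (Finset I)} {P Z : Pattern I} {a : Lit I}
    (ha : ¬ litMem a P) (h : supp D P = supp D (addLit P a)) (hZ : subPat (addLit P a) Z) :
    Occ D (removeLit Z a) = Occ D Z := by
  have hOcc : Occ D (addLit P a) = Occ D P :=
    Finset.eq_of_subset_of_card_le (Occ_subset_of_subPat D (subPat_addLit P a)) h.le
  refine Finset.Subset.antisymm (fun t ht => ?_)
    (Occ_subset_of_subPat D (subPat_removeLit Z a))
  have htP : t ∈ Occ D (addLit P a) :=
    hOcc ▸ Occ_subset_of_subPat D (subPat_removeLit_of_subPat_addLit ha hZ) ht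
  rw [Occ, Finset.mem_filter] at ht htP ⊢
  rw [← addLit_removeLit (litMem_of_subPat_addLit hZ), occursIn_addLit_iff]
  exact ⟨ht.1, ((occursIn_addLit_iff P a t).1 htP.2).1, ht.2⟩

/-- corollary of the main theorem for the composite constraint
`CP[σ₊, σ₋] ∩ GR[θ]`. -/
theorem pruning_sound_for_min_CP_inter_GR (Dp Dm : Finset (Finset I))
    (σp σm : ℕ) (θ : ℝ) (hθ : 0 ≤ θ)
    (P : Pattern I) (a : Lit I) (ha : ¬ litMem a P)
    (h : supp Dm P = supp Dm (addLit P a)) :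
    ∀ Z : Pattern I, subPat (addLit P a) Z →
      Z ∉ MinC (CPset Dp Dm σp σm ∩ GRset Dp Dm θ) := by
  rintro Z hZ ⟨⟨⟨hp, hm⟩, hg⟩, hmin⟩
  have hsm : supp Dm (removeLit Z a) = supp Dm Z :=
    congrArg Finset.card (Occ_removeLit_eq ha h hZ)
  have hsp : supp Dp Z ≤ supp Dp (removeLit Z a) :=
    Finset.card_le_card (Occ_subset_of_subPat Dp (subPat_removeLit Z a))
  have hne : removeLit Z a ≠ Z := fun he =>
    not_litMem_removeLit Z a (he.symm ▸ litMem_of_subPat_addLit hZ)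
  refine hmin _ (subPat_removeLit Z a) hne ⟨⟨hp.trans hsp, hsm.trans_le hm⟩, ?_⟩
  change θ * (supp Dm (removeLit Z a) : ℝ) ≤ (supp Dp (removeLit Z a) : ℝ)
  rw [hsm]
  exact le_trans hg (Nat.cast_le.2 hsp)
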